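/- (Decomposition of the q-Vandermonde matrix.) Fix an integer d ≥ 1 and work with d×d matrices over ℤ[q], indexed by 0 ≤ i, j ≤ d−1. Let Z = (q^{ij})_{i,j}, let U be the upper-triangular unipotent matrix with entries U_{n,k} = [k choose n]_q for n ≤ k (and 0 otherwise), and let D be the diagonal matrix with diagonal entries D_{n,n} = (−1)^n q^{n(n−1)/2} (q;q)_n. Then Z = Uᵀ D U. -/

import Mathlib

/-- The `q`-Pochhammer symbol `(q;q)_n = ∏_{k=1}^n (1 - q^k)` in `ℤ[q]`. -/
noncomputable def qPoch (n : ℕ) : Polynomial ℤ :=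
  ∏ i ∈ Finset.range n, (1 - Polynomial.X ^ (i + 1))

theorem qPoch_zero : qPoch 0 = 1 := by simp [qPoch]

theorem qPoch_succ (n : ℕ) :
    qPoch (n + 1) = qPoch n * (1 - Polynomial.X ^ (n + 1)) := by
  simp [qPoch, Finset.prod_range_succ]

theorem qPoch_ne_zero (n : ℕ) : qPoch n ≠ 0 := by
  intro h
  have := congrArg (Polynomial.eval 0) h
  simp [qPoch, Polynomial.eval_prod] at this

section GaussianBinomial

open Polynomial

variable {B : ℕ → ℕ → ℤ[X]}

theorem gaussianBinomial_zero_right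
    (hB1 : ∀ n k : ℕ, k ≤ n → B n k * (qPoch k * qPoch (n - k)) = qPoch n) (n : ℕ) :
    B n 0 = 1 := by
  have h := hB1 n 0 n.zero_le
  rw [qPoch_zero, one_mul, Nat.sub_zero] at h
  exact mul_right_cancel₀ (qPoch_ne_zero n) (by rw [h, one_mul])

theorem gaussianBinomial_self
    (hB1 : ∀ n k : ℕ, k ≤ n → B n k * (qPoch k * qPoch (n - k)) = qPoch n) (n : ℕ) :
    B n n = 1 := by
  have h := hB1 n n le_rfl
  rw [Nat.sub_self, qPoch_zero, mul_one] at h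
  exact mul_right_cancel₀ (qPoch_ne_zero n) (by rw [h, one_mul])

/-- The `q`-Pascal recurrence. -/
theorem gaussianBinomial_succ_succ (hB0 : ∀ n k : ℕ, n < k → B n k = 0)
    (hB1 : ∀ n k : ℕ, k ≤ n → B n k * (qPoch k * qPoch (n - k)) = qPoch n) (n k : ℕ) :
    B (n + 1) (k + 1) = B n k + X ^ (k + 1) * B n (k + 1) := by
  rcases lt_trichotomy n k with h | rfl | h
  · rw [hB0 _ _ h, hB0 n (k + 1) (by omega), hB0 (n + 1) (k + 1) (by omega)]
    simp
  · rw [gaussianBinomial_self hB1, gaussianBinomial_self hB1, hB0 n (n + 1) (by omega)]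
    simp
  · obtain ⟨c, rfl⟩ := Nat.exists_eq_add_of_lt h
    have h₁ := hB1 (k + c + 1 + 1) (k + 1) (by omega)
    have h₂ := hB1 (k + c + 1) k (by omega)
    have h₃ := hB1 (k + c + 1) (k + 1) (by omega)
    rw [show k + c + 1 + 1 - (k + 1) = c + 1 by omega, qPoch_succ (k + c + 1)] at h₁
    rw [show k + c + 1 - k = c + 1 by omega] at h₂
    rw [show k + c + 1 - (k + 1) = c by omega] at h₃
    refine mul_right_cancel₀ (mul_ne_zero (qPoch_ne_zero (k + 1)) (qPoch_ne_zero (c + 1))) ?_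
    rw [h₁]
    rw [qPoch_succ k, qPoch_succ c] at *
    linear_combination (-(1 - X ^ (k + 1))) * h₂ - X ^ (k + 1) * (1 - X ^ (c + 1)) * h₃

theorem qPoch_succ_mul_gaussianBinomial (hB0 : ∀ n k : ℕ, n < k → B n k = 0)
    (hB1 : ∀ n k : ℕ, k ≤ n → B n k * (qPoch k * qPoch (n - k)) = qPoch n) (n k : ℕ) :
    X ^ k * (qPoch (k + 1) * B n (k + 1)) = (X ^ k - X ^ n) * (qPoch k * B n k) := by
  rcases lt_trichotomy n k with h | rfl | h
  · rw [hB0 _ _ h, hB0 n (k + 1) (by omega)]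
    simp
  · rw [hB0 n (n + 1) (by omega)]
    simp
  · obtain ⟨c, rfl⟩ := Nat.exists_eq_add_of_lt h
    have h₂ := hB1 (k + c + 1) k (by omega)
    have h₃ := hB1 (k + c + 1) (k + 1) (by omega)
    rw [show k + c + 1 - k = c + 1 by omega, qPoch_succ c] at h₂
    rw [show k + c + 1 - (k + 1) = c by omega] at h₃
    refine mul_right_cancel₀ (qPoch_ne_zero c) ?_
    linear_combination X ^ k * h₃ - X ^ k * h₂

/-- The expansion of `x ^ j` at `x = q ^ i` in the basis `∏_{l < n} (x - q ^ l)`. -/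
theorem X_pow_mul_eq_sum_gaussianBinomial (hB0 : ∀ n k : ℕ, n < k → B n k = 0)
    (hB1 : ∀ n k : ℕ, k ≤ n → B n k * (qPoch k * qPoch (n - k)) = qPoch n)
    (i j m : ℕ) (hm : j < m) :
    (X : ℤ[X]) ^ (i * j) = ∑ n ∈ Finset.range m,
      B i n * ((-1) ^ n * X ^ (n * (n - 1) / 2) * qPoch n) * B j n := by
  set T : ℕ → ℤ[X] := fun n => B i n * ((-1) ^ n * X ^ (n * (n - 1) / 2) * qPoch n) with hT
  have hT0 : T 0 = 1 := by
    simp [hT, qPoch_zero, gaussianBinomial_zero_right hB1]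
  have hTs (n : ℕ) : T (n + 1) = (X ^ i - X ^ n) * T n := by
    have h := qPoch_succ_mul_gaussianBinomial hB0 hB1 i n
    have he : (n + 1) * (n + 1 - 1) / 2 = n * (n - 1) / 2 + n := by
      rw [← Finset.sum_range_id, ← Finset.sum_range_id, Finset.sum_range_succ]
    simp only [hT, he, pow_add, pow_one]
    linear_combination (-(-1) ^ n * X ^ (n * (n - 1) / 2)) * h
  change _ = ∑ n ∈ Finset.range m, T n * B j n
  induction j generalizing m with
  | zero =>
    obtain ⟨m, rfl⟩ := Nat.exists_eq_add_of_lt hm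
    rw [Finset.sum_range_succ', Finset.sum_eq_zero fun n _ => by rw [hB0 _ _ n.succ_pos, mul_zero]]
    simp [hT0, gaussianBinomial_zero_right hB1]
  | succ j ih =>
    obtain ⟨m, rfl⟩ : ∃ l, m = l + 1 := ⟨m - 1, by omega⟩
    have hjm : j < m := by omega
    have hshift : ∑ n ∈ Finset.range m, X ^ n * T n * B j n =
        ∑ n ∈ Finset.range m, X ^ (n + 1) * T (n + 1) * B j (n + 1) + 1 := by
      have h := Finset.sum_range_succ' (fun n => X ^ n * T n * B j n) m
      rw [Finset.sum_range_succ, hB0 j m hjm] at h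
      simpa [hT0, gaussianBinomial_zero_right hB1] using h
    rw [mul_add_one, pow_add, ih m hjm, Finset.sum_range_succ', hT0,
      gaussianBinomial_zero_right hB1, mul_one]
    calc (∑ n ∈ Finset.range m, T n * B j n) * X ^ i
        = ∑ n ∈ Finset.range m, T (n + 1) * B j n +
            ∑ n ∈ Finset.range m, X ^ n * T n * B j n := by
          rw [Finset.sum_mul, ← Finset.sum_add_distrib]
          refine Finset.sum_congr rfl fun n _ => ?_
          rw [hTs]
          ring
      _ = ∑ n ∈ Finset.range m, T (n + 1) * B (j + 1) (n + 1) + 1 := by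
          rw [hshift, ← add_assoc, ← Finset.sum_add_distrib]
          congr 1
          refine Finset.sum_congr rfl fun n _ => ?_
          rw [gaussianBinomial_succ_succ hB0 hB1]
          ring

end GaussianBinomial

open Matrix Polynomial in
/-- **Decomposition of the `q`-Vandermonde matrix** (Ophir–de Shalit, Proposition 5 (ii)):
`Z = Uᵀ D U` where `Z = (q^{ij})`, `U_{n,k} = [k choose n]_q` (upper-triangular unipotent) and
`D = diag((−1)^n q^{n(n−1)/2} (q;q)_n)`.  Here `B` is the Gaussian binomial coefficient
`[n choose k]_q ∈ ℤ[q]`, characterized by `[n choose k]_q (q;q)_k (q;q)_{n−k} = (q;q)_n` for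
`k ≤ n` and `[n choose k]_q = 0` for `k > n` (so `U_{n,k} = B k n` vanishes for `k < n`). -/
theorem stmt_7 (d : ℕ) (hd : 1 ≤ d)
    (B : ℕ → ℕ → Polynomial ℤ)
    (hB0 : ∀ n k : ℕ, n < k → B n k = 0)
    (hB1 : ∀ n k : ℕ, k ≤ n → B n k * (qPoch k * qPoch (n - k)) = qPoch n) :
    (Matrix.of fun (i j : Fin d) => (X : ℤ[X]) ^ ((i : ℕ) * (j : ℕ)))
      = (Matrix.of fun (n k : Fin d) => B (k : ℕ) (n : ℕ))ᵀ *
        Matrix.diagonal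
          (fun n : Fin d =>
            (-1) ^ (n : ℕ) * (X : ℤ[X]) ^ ((n : ℕ) * ((n : ℕ) - 1) / 2) * qPoch (n : ℕ)) *
        (Matrix.of fun (n k : Fin d) => B (k : ℕ) (n : ℕ)) := by
  ext1 i j
  rw [Matrix.mul_apply]
  simp only [Matrix.mul_diagonal, Matrix.transpose_apply, Matrix.of_apply]
  rw [X_pow_mul_eq_sum_gaussianBinomial hB0 hB1 i j d j.isLt, Finset.sum_range]
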